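/- For every positive integer n, the pushforward of the law of z under the map x ↦ ∑_{i=1}^n x_i² equals the Gamma measure with shape parameter n/2 and rate parameter 1/2; that is, the sum of squares of n independent standard Gaussians has the chi-squared distribution with n degrees of freedom, which is the Gamma(n/2, 1/2) distribution. -/

import Mathlib

open MeasureTheory ProbabilityTheory

/-- The law of a random vector of `n` i.i.d. standard real Gaussians. -/
noncomputable def stdGaussianPi (n : ℕ) : Measure (Fin n → ℝ) :=
  Measure.pi fun _ => gaussianReal 0 1

/-- A probability measure on `ℝ` whose moment-generating function is finite near `0` is determined
by its moment-generating function. -/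
theorem ext_of_mgf_id_eq {μ ν : Measure ℝ} [IsProbabilityMeasure μ] [IsFiniteMeasure ν]
    (h : mgf id μ = mgf id ν) (h0 : 0 ∈ interior (integrableExpSet id μ)) : μ = ν := by
  refine Measure.ext_of_charFun (funext fun t => ?_)
  rw [← complexMGF_id_mul_I, ← complexMGF_id_mul_I]
  exact eqOn_complexMGF_of_mgf h (by simpa using h0)

theorem measurable_gammaPDF (a r : ℝ) : Measurable (gammaPDF a r) :=
  (measurable_gammaPDFReal a r).ennreal_ofReal

theorem toReal_gammaPDF {a r x : ℝ} (ha : 0 < a) (hr : 0 < r) :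
    (gammaPDF a r x).toReal = gammaPDFReal a r x :=
  ENNReal.toReal_ofReal (gammaPDFReal_nonneg ha hr x)

theorem mgf_id_gammaMeasure {a r t : ℝ} (ha : 0 < a) (hr : 0 < r) (ht : t < r) :
    mgf id (gammaMeasure a r) t = (r / (r - t)) ^ a := by
  have hrt : 0 < r - t := sub_pos.2 ht
  have hpdf : ∀ x, (gammaPDF a r x).toReal • Real.exp (t * x)
      = (Set.Ici 0).indicator
          (fun x => r ^ a / Real.Gamma a * (x ^ (a - 1) * Real.exp (-((r - t) * x)))) x := by
    intro x
    rw [toReal_gammaPDF ha hr, gammaPDFReal, Set.indicator_apply]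
    simp only [Set.mem_Ici, smul_eq_mul]
    split_ifs
    · rw [show -((r - t) * x) = -(r * x) + t * x by ring, Real.exp_add]
      ring
    · simp
  simp only [mgf, id]
  rw [gammaMeasure, integral_withDensity_eq_integral_toReal_smul
    (measurable_gammaPDF a r) (ae_of_all _ fun _ => ENNReal.ofReal_lt_top)]
  simp_rw [hpdf]
  rw [integral_indicator measurableSet_Ici, integral_Ici_eq_integral_Ioi, integral_const_mul,
    Real.integral_rpow_mul_exp_neg_mul_Ioi ha hrt, Real.div_rpow hr.le hrt.le,
    Real.div_rpow zero_le_one hrt.le, Real.one_rpow]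
  have := (Real.Gamma_pos_of_pos ha).ne'
  field_simp

theorem not_integrable_exp_mul_gammaMeasure {a r t : ℝ} (ha : 0 < a) (hr : 0 < r) (ht : r ≤ t) :
    ¬ Integrable (fun x => Real.exp (t * x)) (gammaMeasure a r) := by
  intro h
  rw [gammaMeasure, integrable_withDensity_iff_integrable_smul'
    (measurable_gammaPDF a r)
    (ae_of_all _ fun _ => ENNReal.ofReal_lt_top)] at h
  have hc : 0 < r ^ a / Real.Gamma a := by positivity
  have hdom : IntegrableOn (fun x : ℝ => r ^ a / Real.Gamma a * x ^ (a - 1)) (Set.Ioi 1) := by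
    refine h.integrableOn.mono' (by fun_prop) ?_
    refine (ae_restrict_iff' measurableSet_Ioi).2 (ae_of_all _ fun x (hx : 1 < x) => ?_)
    have hx0 : 0 ≤ x := by linarith
    rw [toReal_gammaPDF ha hr, gammaPDFReal, if_pos hx0, smul_eq_mul, mul_assoc,
      ← Real.exp_add, Real.norm_of_nonneg (by positivity)]
    exact le_mul_of_one_le_right (by positivity) (Real.one_le_exp (by nlinarith))
  have := (integrableOn_Ioi_rpow_iff one_pos).1
    ((integrable_const_mul_iff hc.ne'.isUnit _).1 hdom)
  linarith

theorem mgf_sq_gaussianReal (t : ℝ) :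
    mgf (fun x => x ^ 2) (gaussianReal 0 1) t = √(1 / 2 / (1 / 2 - t)) := by
  have hpdf : ∀ x, gaussianPDFReal 0 1 x • Real.exp (t * x ^ 2)
      = (√(2 * Real.pi))⁻¹ * Real.exp (-(1 / 2 - t) * x ^ 2) := by
    intro x
    rw [gaussianPDFReal, smul_eq_mul, mul_assoc, ← Real.exp_add]
    simp only [NNReal.coe_one, mul_one, sub_zero]
    ring_nf
  rw [mgf, integral_gaussianReal_eq_integral_smul one_ne_zero]
  simp_rw [hpdf]
  rw [integral_const_mul, integral_gaussian, ← Real.sqrt_inv, ← Real.sqrt_mul (by positivity)]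
  congr 1
  have := Real.pi_pos.ne'
  field_simp

theorem mgf_sum_sq_stdGaussianPi (n : ℕ) (t : ℝ) :
    mgf (fun z => ∑ i, z i ^ 2) (stdGaussianPi n) t = √(1 / 2 / (1 / 2 - t)) ^ n := by
  simp only [mgf, stdGaussianPi, Finset.mul_sum, Real.exp_sum]
  rw [integral_fintype_prod_eq_pow (fun x : ℝ => Real.exp (t * x ^ 2)), Fintype.card_fin,
    ← mgf_sq_gaussianReal, mgf]

/-- The sum of squares of `n` i.i.d. standard Gaussians has the chi-squared distribution
with `n` degrees of freedom, i.e. the Gamma distribution with shape `n/2` and rate `1/2`. -/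
theorem chiSq_eq_gamma (n : ℕ) (hn : 0 < n) :
    Measure.map (fun z => ∑ i, z i ^ 2) (stdGaussianPi n)
      = gammaMeasure ((n : ℝ) / 2) (1 / 2) := by
  have ha : 0 < (n : ℝ) / 2 := by positivity
  have hr : (0 : ℝ) < 1 / 2 := by norm_num
  have hmeas : Measurable fun z : Fin n → ℝ => ∑ i, z i ^ 2 := by fun_prop
  have : IsProbabilityMeasure (stdGaussianPi n) := by
    unfold stdGaussianPi
    infer_instance
  have := Measure.isProbabilityMeasure_map (μ := stdGaussianPi n) hmeas.aemeasurable
  have := isProbabilityMeasure_gammaMeasure ha hr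
  refine (ext_of_mgf_id_eq (funext fun t => ?_) ?_).symm
  · rw [mgf_id_map hmeas.aemeasurable, mgf_sum_sq_stdGaussianPi]
    rcases lt_or_ge t (1 / 2) with ht | ht
    · have hq : 0 ≤ 1 / 2 / (1 / 2 - t) := div_nonneg hr.le (sub_pos.2 ht).le
      rw [mgf_id_gammaMeasure ha hr ht, Real.sqrt_eq_rpow, ← Real.rpow_mul_natCast hq]
      congr 1
      ring
    · rw [mgf_undef (X := id) (not_integrable_exp_mul_gammaMeasure ha hr ht), Real.sqrt_eq_zero_of_nonpos
        (div_nonpos_of_nonneg_of_nonpos hr.le (sub_nonpos.2 ht)), zero_pow hn.ne']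
  · refine mem_interior.2 ⟨Set.Iio (1 / 2), fun t (ht : t < 1 / 2) => ?_, isOpen_Iio, hr⟩
    rw [integrableExpSet, Set.mem_ofPred_eq, ← mgf_pos_iff, mgf_id_gammaMeasure ha hr ht]
    exact Real.rpow_pos_of_pos (div_pos hr (sub_pos.2 ht)) _
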